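/- (Theorem 3.2, dissipation inequality for the linear controller, spectral form.) Fix σ > 0 and, for (w, y) ∈ D × ℝ^N, set u := w + Σ_{i=1}^N y_i χ_i and define the controller v_i(w) := Σ_{m=1}^N g_{i,m}(σ − λ_m)⟨φ_m, w⟩ for i = 1,…,N. Suppose there exists a constant κ > 0 such that σ² > L̄²(1 + κN), λ_{N+1}² > L̄²(1 + κN)(1 + 2N Σ_{i=1}^N Σ_{m=1}^N ‖χ_i‖² g_{i,m}² (σ − λ_m)² / (σ² − L̄²(1 + κN))), and μ_i² > 2N L̄² (1 + 1/κ) ‖χ_i‖² Σ_{m=1}^N g_{i,m}² (σ − λ_m)² / (σ² − L̄²(1 + κN)) for every i = 1,…,N. Then there exist constants ω₁,…,ω_N > 0, γ > 0, R > 0 and θ > 0 such that for all (w, y) ∈ D × ℝ^N, V̇(w, y, v(w)) ≤ −θ(‖w‖² + Σ_{i=1}^N y_i²), where V̇(w, y, v) := R Σ_{n=1}^N ⟨φ_n, w⟩⟨φ_n, ẇ⟩ + Σ_{i=1}^N ω_i y_i v_i − Σ_{i=1}^N μ_i ω_i y_i² + γ ⟨w − Pw, ẇ − Pẇ⟩ with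 ẇ := −Aw − Σ_{i=1}^N v_i χ_i + F(u). -/

import Mathlib

open scoped RealInnerProductSpace

/- Setting: real Hilbert space with orthonormal basis (φ_n)_{n∈ℕ} (0-indexed, so the
paper's φ_{n+1} is φ n here and the paper's λ_{N+1} is `lam N`). -/

/-- The operator `A` (diagonal w.r.t. the basis `φ` with eigenvalues `lam`). -/
noncomputable def Aop {H : Type*} [NormedAddCommGroup H] [InnerProductSpace ℝ H]
    (φ : ℕ → H) (lam : ℕ → ℝ) (w : H) : H :=
  ∑' n : ℕ, (lam n * ⟪φ n, w⟫) • φ n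

/-- The orthogonal projection `P` onto the span of the first `N` basis vectors. -/
noncomputable def Pop {H : Type*} [NormedAddCommGroup H] [InnerProductSpace ℝ H]
    (φ : ℕ → H) (N : ℕ) (w : H) : H :=
  ∑ n ∈ Finset.range N, ⟪φ n, w⟫ • φ n

/-- The expression (3.17) for the derivative of the CLF `V` along solutions of the
semilinear problem, with `ẇ = -Aw - Σ v_i χ_i + F(u)` and `u = w + Σ y_i χ_i`. -/
noncomputable def VdotNL {H : Type*} [NormedAddCommGroup H] [InnerProductSpace ℝ H]
    (φ : ℕ → H) (lam : ℕ → ℝ) (N : ℕ) (χ : Fin N → H) (μ ω : Fin N → ℝ)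
    (γ R : ℝ) (F : H → H) (w : H) (y v : Fin N → ℝ) : ℝ :=
  let u : H := w + ∑ i, y i • χ i
  let wd : H := -Aop φ lam w - ∑ i, v i • χ i + F u
  R * ∑ n ∈ Finset.range N, ⟪φ n, w⟫ * ⟪φ n, wd⟫
    + ∑ i, ω i * y i * v i - ∑ i, μ i * ω i * y i ^ 2
    + γ * ⟪w - Pop φ N w, wd - Pop φ N wd⟫

section Projection

variable {H : Type*} [NormedAddCommGroup H] [InnerProductSpace ℝ H]

lemma inner_Pop (φ : ℕ → H) (N : ℕ) (w x : H) :
    ⟪Pop φ N w, x⟫ = ∑ n ∈ Finset.range N, ⟪φ n, w⟫ * ⟪φ n, x⟫ := by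
  simp [Pop, sum_inner, real_inner_smul_left]

lemma inner_basis_Pop {φ : ℕ → H} (hon : Orthonormal ℝ φ) (N : ℕ) (w : H) (k : ℕ) :
    ⟪φ k, Pop φ N w⟫ = if k < N then ⟪φ k, w⟫ else 0 := by
  simp [Pop, inner_sum, real_inner_smul_right, orthonormal_iff_ite.mp hon]

lemma inner_basis_sub_Pop {φ : ℕ → H} (hon : Orthonormal ℝ φ) (N : ℕ) (w : H) (k : ℕ) :
    ⟪φ k, w - Pop φ N w⟫ = if k < N then 0 else ⟪φ k, w⟫ := by
  rw [inner_sub_right, inner_basis_Pop hon]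
  split_ifs <;> simp

lemma inner_Pop_sub_Pop {φ : ℕ → H} (hon : Orthonormal ℝ φ) (N : ℕ) (w x : H) :
    ⟪Pop φ N x, w - Pop φ N w⟫ = 0 := by
  rw [inner_Pop]
  refine Finset.sum_eq_zero fun n hn => ?_
  rw [inner_basis_sub_Pop hon, if_pos (Finset.mem_range.mp hn), mul_zero]

lemma norm_Pop_sq {φ : ℕ → H} (hon : Orthonormal ℝ φ) (N : ℕ) (w : H) :
    ‖Pop φ N w‖ ^ 2 = ∑ n ∈ Finset.range N, ⟪φ n, w⟫ ^ 2 := by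
  rw [← real_inner_self_eq_norm_sq, inner_Pop]
  refine Finset.sum_congr rfl fun n hn => ?_
  rw [inner_basis_Pop hon, if_pos (Finset.mem_range.mp hn), sq]

lemma norm_smul_Pop_add_smul_sq {φ : ℕ → H} (hon : Orthonormal ℝ φ) (N : ℕ) (w : H) (a b : ℝ) :
    ‖a • Pop φ N w + b • (w - Pop φ N w)‖ ^ 2
      = a ^ 2 * ‖Pop φ N w‖ ^ 2 + b ^ 2 * ‖w - Pop φ N w‖ ^ 2 := by
  rw [norm_add_sq_real, real_inner_smul_left, real_inner_smul_right, inner_Pop_sub_Pop hon,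
    norm_smul, norm_smul, mul_pow, mul_pow, Real.norm_eq_abs, Real.norm_eq_abs, sq_abs, sq_abs]
  ring

lemma norm_sq_eq_Pop_add {φ : ℕ → H} (hon : Orthonormal ℝ φ) (N : ℕ) (w : H) :
    ‖w‖ ^ 2 = ‖Pop φ N w‖ ^ 2 + ‖w - Pop φ N w‖ ^ 2 := by
  simpa using norm_smul_Pop_add_smul_sq hon N w 1 1

lemma norm_sum_smul_sq_of_orthogonal {ι : Type*} [Fintype ι] {χ : ι → H}
    (hχ : ∀ i m : ι, i ≠ m → ⟪χ i, χ m⟫ = 0) (y : ι → ℝ) :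
    ‖∑ i, y i • χ i‖ ^ 2 = ∑ i, y i ^ 2 * ‖χ i‖ ^ 2 := by
  classical
  rw [← real_inner_self_eq_norm_sq, sum_inner]
  refine Finset.sum_congr rfl fun i _ => ?_
  rw [inner_sum, Finset.sum_eq_single i]
  · rw [real_inner_smul_left, real_inner_smul_right, real_inner_self_eq_norm_sq]
    ring
  · intro m _ hm
    rw [real_inner_smul_left, real_inner_smul_right, hχ i m hm.symm]
    ring
  · simp

lemma norm_add_sq_le_young {κ : ℝ} (hκ : 0 < κ) (w z : H) :
    ‖w + z‖ ^ 2 ≤ (1 + κ) * ‖w‖ ^ 2 + (1 + 1 / κ) * ‖z‖ ^ 2 := by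
  have hcs := real_inner_le_norm w z
  have h2 : 2 * (‖w‖ * ‖z‖) ≤ κ * ‖w‖ ^ 2 + 1 / κ * ‖z‖ ^ 2 := by
    have : κ * ‖w‖ ^ 2 + 1 / κ * ‖z‖ ^ 2 - 2 * (‖w‖ * ‖z‖) = (κ * ‖w‖ - ‖z‖) ^ 2 / κ := by
      field_simp
      ring
    have : 0 ≤ (κ * ‖w‖ - ‖z‖) ^ 2 / κ := by positivity
    linarith
  rw [norm_add_sq_real]
  linarith

end Projection

section Spectral

variable {H : Type*} [NormedAddCommGroup H] [InnerProductSpace ℝ H] [CompleteSpace H]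
  {φ : ℕ → H} {lam : ℕ → ℝ} {w : H}

lemma hasSum_Aop (hon : Orthonormal ℝ φ) (hw : Summable fun n : ℕ => lam n ^ 2 * ⟪φ n, w⟫ ^ 2) :
    HasSum (fun n => (lam n * ⟪φ n, w⟫) • φ n) (Aop φ lam w) := by
  refine Summable.hasSum ?_
  have := (hon.orthogonalFamily.summable_iff_norm_sq_summable
    (fun n => lam n * ⟪φ n, w⟫)).mpr (by simpa [mul_pow] using hw)
  simpa using this

lemma hasSum_inner_Aop (hon : Orthonormal ℝ φ)
    (hw : Summable fun n : ℕ => lam n ^ 2 * ⟪φ n, w⟫ ^ 2) (x : H) :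
    HasSum (fun n => lam n * ⟪φ n, w⟫ * ⟪φ n, x⟫) ⟪x, Aop φ lam w⟫ := by
  simpa [real_inner_smul_right, real_inner_comm] using
    (hasSum_Aop hon hw).mapL (innerSL ℝ x)

lemma inner_basis_Aop (hon : Orthonormal ℝ φ)
    (hw : Summable fun n : ℕ => lam n ^ 2 * ⟪φ n, w⟫ ^ 2) (k : ℕ) :
    ⟪φ k, Aop φ lam w⟫ = lam k * ⟪φ k, w⟫ := by
  refine (hasSum_inner_Aop hon hw (φ k)).unique ?_
  convert hasSum_ite_eq k (lam k * ⟪φ k, w⟫) using 2 with n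
  rw [orthonormal_iff_ite.mp hon]
  split_ifs with h
  · rw [h, mul_one]
  · rw [mul_zero]

lemma le_inner_sub_Pop_Aop (hon : Orthonormal ℝ φ)
    (htot : ⊤ ≤ (Submodule.span ℝ (Set.range φ)).topologicalClosure) (hlam : Monotone lam)
    (hw : Summable fun n : ℕ => lam n ^ 2 * ⟪φ n, w⟫ ^ 2) (N : ℕ) :
    lam N * ‖w - Pop φ N w‖ ^ 2 ≤ ⟪w - Pop φ N w, Aop φ lam w⟫ := by
  set q := w - Pop φ N w with hq
  have hnorm : HasSum (fun n => ⟪φ n, q⟫ ^ 2) (‖q‖ ^ 2) := by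
    have := (HilbertBasis.mk hon htot).hasSum_inner_mul_inner q q
    simpa [HilbertBasis.coe_mk, real_inner_comm, sq, real_inner_self_eq_norm_sq] using this
  refine hasSum_le (fun n => ?_) (hnorm.mul_left (lam N)) (hasSum_inner_Aop hon hw q)
  rw [hq, inner_basis_sub_Pop hon]
  split_ifs with h
  · simp
  · have := mul_le_mul_of_nonneg_right (hlam (not_lt.mp h)) (sq_nonneg ⟪φ n, w⟫)
    linarith

end Spectral

/-- Absorption of the cross term `y * v` by the damping `μ * ω * y ^ 2`. -/
lemma exists_weight_cross_term {μ b c S : ℝ} (hμ : 0 < μ) (hb : 0 < b) (hS : 0 ≤ S)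
    (h : c * S < μ ^ 2 * b) :
    ∃ ω δ : ℝ, 0 < ω ∧ 0 < δ ∧ ∀ y v p : ℝ, 0 ≤ p → v ^ 2 ≤ S * p →
      ω * y * v - μ * ω * y ^ 2 + c * y ^ 2 ≤ (b - δ) * p - δ * y ^ 2 := by
  obtain ⟨ε, hε, hεb, hε'⟩ : ∃ ε : ℝ, 0 < ε ∧ ε < b ∧ c * (S + ε) < μ ^ 2 * (b - ε) := by
    have hlim : Filter.Tendsto (fun ε : ℝ => μ ^ 2 * (b - ε) - c * (S + ε))
        (nhdsWithin 0 (Set.Ioi 0)) (nhds (μ ^ 2 * (b - 0) - c * (S + 0))) :=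
      (Continuous.tendsto (by fun_prop) 0).mono_left nhdsWithin_le_nhds
    have h1 := hlim.eventually (lt_mem_nhds (show (0 : ℝ) < _ by simpa using h))
    have h2 : Set.Ioo 0 b ∈ nhdsWithin (0 : ℝ) (Set.Ioi 0) := Ioo_mem_nhdsGT hb
    obtain ⟨ε, h3, h4⟩ := (h1.and h2).exists
    exact ⟨ε, h4.1, h4.2, by linarith⟩
  have hS' : 0 < S + ε := by linarith
  have hb' : 0 < b - ε := by linarith
  have hd : 0 < μ ^ 2 * (b - ε) / (S + ε) - c := by
    rw [sub_pos, lt_div_iff₀ hS']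
    exact hε'
  refine ⟨2 * μ * (b - ε) / (S + ε), min ε (μ ^ 2 * (b - ε) / (S + ε) - c), by positivity,
    lt_min hε hd, fun y v p hp hv => ?_⟩
  have hyoung : 2 * μ * (b - ε) / (S + ε) * y * v - μ * (2 * μ * (b - ε) / (S + ε)) * y ^ 2
      ≤ (b - ε) / (S + ε) * v ^ 2 - μ ^ 2 * (b - ε) / (S + ε) * y ^ 2 := by
    have : (b - ε) / (S + ε) * v ^ 2 - μ ^ 2 * (b - ε) / (S + ε) * y ^ 2
      - (2 * μ * (b - ε) / (S + ε) * y * v - μ * (2 * μ * (b - ε) / (S + ε)) * y ^ 2)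
      = (b - ε) / (S + ε) * (v - μ * y) ^ 2 := by ring
    have : 0 ≤ (b - ε) / (S + ε) * (v - μ * y) ^ 2 := by positivity
    linarith
  have hvp : (b - ε) / (S + ε) * v ^ 2 ≤ (b - ε) * p := by
    rw [div_mul_eq_mul_div, div_le_iff₀ hS', mul_assoc]
    refine mul_le_mul_of_nonneg_left ?_ hb'.le
    nlinarith
  have h1 := mul_le_mul_of_nonneg_right (min_le_left ε (μ ^ 2 * (b - ε) / (S + ε) - c)) hp
  have h2 := mul_le_mul_of_nonneg_right (min_le_right ε (μ ^ 2 * (b - ε) / (S + ε) - c))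
    (sq_nonneg y)
  linarith

lemma exists_pos_le_of_forall_pos {ι : Type*} [Finite ι] {δ : ι → ℝ} (hδ : ∀ i, 0 < δ i) :
    ∃ d : ℝ, 0 < d ∧ ∀ i, d ≤ δ i := by
  have h : ∀ᶠ d in nhdsWithin (0 : ℝ) (Set.Ioi 0), ∀ i, d ≤ δ i :=
    Filter.eventually_all.mpr fun i => Ioc_mem_nhdsGT (hδ i) |> Filter.mem_of_superset <|
      fun _ hx => hx.2
  obtain ⟨d, h1, h2⟩ := (h.and self_mem_nhdsWithin).exists
  exact ⟨d, h2, h1⟩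

lemma sum_feedback_mul_inner {H : Type*} [NormedAddCommGroup H] [InnerProductSpace ℝ H]
    {φ : ℕ → H} {N : ℕ} {χ : Fin N → H} {B g : Matrix (Fin N) (Fin N) ℝ}
    (hB : ∀ n i : Fin N, B n i = -⟪χ i, φ (n : ℕ)⟫) (hBunit : IsUnit B) (hg : g = -B⁻¹)
    (d : Fin N → ℝ) (n : Fin N) :
    ∑ i, (∑ m, g i m * d m) * ⟪φ (n : ℕ), χ i⟫ = d n := by
  have h : B.mulVec (g.mulVec d) = -d := by
    rw [Matrix.mulVec_mulVec, hg, mul_neg,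
      Matrix.mul_nonsing_inv B ((Matrix.isUnit_iff_isUnit_det B).mp hBunit), Matrix.neg_mulVec,
      Matrix.one_mulVec]
  have hn := congrFun h n
  simp only [Matrix.mulVec, dotProduct, hB, Pi.neg_apply, neg_mul, Finset.sum_neg_distrib,
    neg_inj] at hn
  rw [← hn]
  refine Finset.sum_congr rfl fun i _ => ?_
  rw [real_inner_comm, mul_comm]

lemma inner_Pop_closedLoop {H : Type*} [NormedAddCommGroup H] [InnerProductSpace ℝ H]
    [CompleteSpace H] {φ : ℕ → H} (hon : Orthonormal ℝ φ) {lam : ℕ → ℝ} {N : ℕ}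
    {χ : Fin N → H} {v : Fin N → ℝ} {σ : ℝ} {w : H}
    (hw : Summable fun n : ℕ => lam n ^ 2 * ⟪φ n, w⟫ ^ 2)
    (hv : ∀ n : Fin N, ∑ i, v i * ⟪φ (n : ℕ), χ i⟫ = (σ - lam n) * ⟪φ (n : ℕ), w⟫) (f : H) :
    ⟪Pop φ N w, -Aop φ lam w - ∑ i, v i • χ i + f⟫
      = -σ * ‖Pop φ N w‖ ^ 2 + ⟪Pop φ N w, f⟫ := by
  rw [norm_Pop_sq hon, inner_Pop, inner_Pop, Finset.mul_sum, ← Finset.sum_add_distrib]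
  refine Finset.sum_congr rfl fun n hn => ?_
  have := hv ⟨n, Finset.mem_range.mp hn⟩
  simp only at this
  rw [inner_add_right, inner_sub_right, inner_neg_right, inner_basis_Aop hon hw, inner_sum]
  simp only [real_inner_smul_right]
  rw [this]
  ring

lemma VdotNL_eq {H : Type*} [NormedAddCommGroup H] [InnerProductSpace ℝ H]
    {φ : ℕ → H} (hon : Orthonormal ℝ φ) (lam : ℕ → ℝ) (N : ℕ) (χ : Fin N → H)
    (μ ω : Fin N → ℝ) (γ R : ℝ) (F : H → H) (w : H) (y v : Fin N → ℝ) :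
    VdotNL φ lam N χ μ ω γ R F w y v
      = R * ⟪Pop φ N w, -Aop φ lam w - ∑ i, v i • χ i + F (w + ∑ i, y i • χ i)⟫
        + ∑ i, (ω i * y i * v i - μ i * ω i * y i ^ 2)
        + γ * ⟪w - Pop φ N w, -Aop φ lam w - ∑ i, v i • χ i + F (w + ∑ i, y i • χ i)⟫ := by
  rw [VdotNL, inner_sub_right (w - Pop φ N w) _ (Pop φ N _),
    real_inner_comm (Pop φ N _) (w - Pop φ N w), inner_Pop_sub_Pop hon, inner_Pop,
    Finset.sum_sub_distrib]
  ring

lemma feedback_sq_le {N : ℕ} (g : Matrix (Fin N) (Fin N) ℝ) (d : Fin N → ℝ) (p : ℕ → ℝ)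
    (i : Fin N) :
    (∑ m : Fin N, g i m * d m * p m) ^ 2
      ≤ (∑ m, g i m ^ 2 * d m ^ 2) * ∑ n ∈ Finset.range N, p n ^ 2 := by
  have := Finset.sum_mul_sq_le_sq_mul_sq Finset.univ (fun m => g i m * d m) (fun m => p m)
  simpa [mul_pow, Finset.sum_range] using this

lemma cross_term_le {b T P Q x l : ℝ} (hb : 0 < b) (hT : 0 ≤ T) (hP : 0 ≤ P) (hQ : 0 ≤ Q)
    (hx : x ^ 2 ≤ Q * (T * P)) :
    -2 * l * x ≤ b / 2 * P + 2 * T / b * l ^ 2 * Q := by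
  refine le_of_abs_le (abs_le_of_sq_le_sq ?_ (by positivity))
  have h1 : (-2 * l * x) ^ 2 ≤ 4 * l ^ 2 * (Q * (T * P)) := by nlinarith [sq_nonneg l]
  have h2 : (b / 2 * P + 2 * T / b * l ^ 2 * Q) ^ 2
      = (b / 2 * P - 2 * T / b * l ^ 2 * Q) ^ 2 + 4 * l ^ 2 * (Q * (T * P)) := by
    field_simp
    ring
  nlinarith [sq_nonneg (b / 2 * P - 2 * T / b * l ^ 2 * Q)]

lemma norm_sq_nonlinearity_le {H : Type*} [NormedAddCommGroup H] [InnerProductSpace ℝ H]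
    {N : ℕ} (hN : 1 ≤ N) {χ : Fin N → H} (hχ : ∀ i m : Fin N, i ≠ m → ⟪χ i, χ m⟫ = 0)
    {F : H → H} {L κ : ℝ} (hκ : 0 < κ) (hF : ∀ u : H, ‖F u‖ ≤ L * ‖u‖)
    (w : H) (y : Fin N → ℝ) :
    ‖F (w + ∑ i, y i • χ i)‖ ^ 2 ≤ L ^ 2 * (1 + κ * N) * ‖w‖ ^ 2
      + ∑ i, L ^ 2 * (1 + 1 / κ) * ‖χ i‖ ^ 2 * y i ^ 2 := by
  have hN' : (1 : ℝ) ≤ N := by exact_mod_cast hN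
  have h1 : ‖F (w + ∑ i, y i • χ i)‖ ^ 2 ≤ L ^ 2 * ‖w + ∑ i, y i • χ i‖ ^ 2 := by
    rw [← mul_pow]
    exact pow_le_pow_left₀ (norm_nonneg _) (hF _) 2
  have h2 := norm_add_sq_le_young hκ w (∑ i, y i • χ i)
  have h3 : (1 + κ) * ‖w‖ ^ 2 ≤ (1 + κ * N) * ‖w‖ ^ 2 := by
    gcongr
    nlinarith
  rw [norm_sum_smul_sq_of_orthogonal hχ] at h2
  have h4 : ∑ i, L ^ 2 * (1 + 1 / κ) * ‖χ i‖ ^ 2 * y i ^ 2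
      = L ^ 2 * ((1 + 1 / κ) * ∑ i, y i ^ 2 * ‖χ i‖ ^ 2) := by
    rw [Finset.mul_sum, Finset.mul_sum]
    exact Finset.sum_congr rfl fun i _ => by ring
  rw [h4]
  nlinarith [mul_le_mul_of_nonneg_left (h2.trans (add_le_add_left h3 _)) (sq_nonneg L)]

/- STATEMENT 14 (Theorem 3.2, dissipation inequality for the linear controller
(3.11), spectral form). -/

theorem stmt_14 {H : Type*} [NormedAddCommGroup H] [InnerProductSpace ℝ H] [CompleteSpace H]
    (φ : ℕ → H) (hon : Orthonormal ℝ φ)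
    (htot : ⊤ ≤ (Submodule.span ℝ (Set.range φ)).topologicalClosure)
    (lam : ℕ → ℝ) (hlam : StrictMono lam)
    (N : ℕ) (hN : 1 ≤ N) (hpos : 0 < lam N)
    (χ : Fin N → H) (hχ : ∀ i m : Fin N, i ≠ m → ⟪χ i, χ m⟫ = 0)
    (μ : Fin N → ℝ) (hμ : ∀ i, 0 < μ i)
    (B : Matrix (Fin N) (Fin N) ℝ)
    (hB : ∀ (n i : Fin N), B n i = -⟪χ i, φ (n : ℕ)⟫)
    (hBunit : IsUnit B)
    (g : Matrix (Fin N) (Fin N) ℝ) (hg : g = -B⁻¹)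
    (F : H → H) (hFcont : Continuous F) (hF0 : F 0 = 0)
    (Lbar : ℝ) (hLbar : 0 ≤ Lbar) (hFgrowth : ∀ u : H, ‖F u‖ ≤ Lbar * ‖u‖)
    (σ : ℝ) (hσ : 0 < σ)
    (κ : ℝ) (hκ : 0 < κ)
    (hcond0 : σ ^ 2 > Lbar ^ 2 * (1 + κ * N))
    (hcond2 : lam N ^ 2
      > Lbar ^ 2 * (1 + κ * N)
        * (1 + 2 * N * ∑ i, ∑ m,
            ‖χ i‖ ^ 2 * g i m ^ 2 * (σ - lam (m : ℕ)) ^ 2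
              / (σ ^ 2 - Lbar ^ 2 * (1 + κ * N))))
    (hcond1 : ∀ i, μ i ^ 2
      > 2 * N * Lbar ^ 2 * (1 + 1 / κ) * ‖χ i‖ ^ 2
        * ∑ m, g i m ^ 2 * (σ - lam (m : ℕ)) ^ 2
            / (σ ^ 2 - Lbar ^ 2 * (1 + κ * N))) :
    ∃ (ω : Fin N → ℝ) (γ R θ : ℝ),
      (∀ i, 0 < ω i) ∧ 0 < γ ∧ 0 < R ∧ 0 < θ ∧
      ∀ w : H, (Summable fun n : ℕ => lam n ^ 2 * ⟪φ n, w⟫ ^ 2) →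
        ∀ y : Fin N → ℝ,
          VdotNL φ lam N χ μ ω γ R F w y
            (fun i => ∑ m : Fin N, g i m * (σ - lam (m : ℕ)) * ⟪φ (m : ℕ), w⟫)
          ≤ -θ * (‖w‖ ^ 2 + ∑ i, y i ^ 2) := by
  set a : ℝ := Lbar ^ 2 * (1 + κ * N) with ha
  set b : ℝ := σ ^ 2 - a with hb_def
  set S : Fin N → ℝ := fun i => ∑ m : Fin N, g i m ^ 2 * (σ - lam (m : ℕ)) ^ 2 with hS_def
  set T : ℝ := ∑ i, ‖χ i‖ ^ 2 * S i with hT_def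
  have hN' : (1 : ℝ) ≤ N := by exact_mod_cast hN
  have hNpos : (0 : ℝ) < N := by linarith
  have hb : 0 < b := sub_pos.mpr hcond0
  have ha0 : 0 ≤ a := by positivity
  have hS : ∀ i, 0 ≤ S i := fun i => by positivity
  have hT : 0 ≤ T := Finset.sum_nonneg fun i _ => mul_nonneg (sq_nonneg _) (hS i)
  have hsumT : ∑ i, ∑ m : Fin N, ‖χ i‖ ^ 2 * g i m ^ 2 * (σ - lam (m : ℕ)) ^ 2 / b = T / b := by
    simp only [hT_def, hS_def, Finset.sum_div, Finset.mul_sum, mul_assoc]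
  rw [hsumT] at hcond2
  have hD : (0 : ℝ) < 1 + 2 * T / b := by positivity
  obtain ⟨t, ht, htD⟩ : ∃ t : ℝ, 0 < t ∧ t * (1 + 2 * T / b) = 1 :=
    ⟨(1 + 2 * T / b)⁻¹, inv_pos.mpr hD, inv_mul_cancel₀ hD.ne'⟩
  have hgap : 0 < lam N ^ 2 * t - a := by
    have h1 : a * (1 + 2 * T / b) < lam N ^ 2 := by
      refine lt_of_le_of_lt (mul_le_mul_of_nonneg_left ?_ ha0) hcond2
      have : 1 * (T / b) ≤ N * (T / b) := mul_le_mul_of_nonneg_right hN' (by positivity)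
      rw [mul_div_assoc]
      linarith
    have h2 := mul_lt_mul_of_pos_right h1 ht
    rw [mul_assoc, mul_comm _ t, htD] at h2
    linarith
  have hweights : ∀ i, ∃ ω δ : ℝ, 0 < ω ∧ 0 < δ ∧ ∀ y v p : ℝ, 0 ≤ p → v ^ 2 ≤ S i * p →
      ω * y * v - μ i * ω * y ^ 2 + Lbar ^ 2 * (1 + 1 / κ) * ‖χ i‖ ^ 2 * y ^ 2
        ≤ (b / (2 * N) - δ) * p - δ * y ^ 2 := by
    refine fun i => exists_weight_cross_term (hμ i) (by positivity) (hS i) ?_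
    have h := hcond1 i
    rw [← Finset.sum_div] at h
    change 2 * N * Lbar ^ 2 * (1 + 1 / κ) * ‖χ i‖ ^ 2 * (S i / b) < μ i ^ 2 at h
    calc Lbar ^ 2 * (1 + 1 / κ) * ‖χ i‖ ^ 2 * S i
        = 2 * N * Lbar ^ 2 * (1 + 1 / κ) * ‖χ i‖ ^ 2 * (S i / b) * (b / (2 * N)) := by
          field_simp
      _ < μ i ^ 2 * (b / (2 * N)) := mul_lt_mul_of_pos_right h (by positivity)
  choose ω δ hω hδ hωδ using hweights
  obtain ⟨d, hd, hdδ⟩ := exists_pos_le_of_forall_pos hδ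
  refine ⟨ω, 2 * (lam N * t), 2 * σ, min d (lam N ^ 2 * t - a), hω, by positivity, by positivity,
    lt_min hd hgap, fun w hw y => ?_⟩
  set v : Fin N → ℝ := fun i => ∑ m : Fin N, g i m * (σ - lam (m : ℕ)) * ⟪φ (m : ℕ), w⟫
    with hv_def
  set f := F (w + ∑ i, y i • χ i) with hf
  set q := w - Pop φ N w with hq
  have hv : ∀ n : Fin N, ∑ i, v i * ⟪φ (n : ℕ), χ i⟫ = (σ - lam n) * ⟪φ (n : ℕ), w⟫ := fun n => by
    simpa only [hv_def, mul_assoc] using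
      sum_feedback_mul_inner hB hBunit hg (fun m => (σ - lam m) * ⟪φ (m : ℕ), w⟫) n
  have hvsq : ∀ i, v i ^ 2 ≤ S i * ‖Pop φ N w‖ ^ 2 := fun i => by
    rw [norm_Pop_sq hon]
    exact feedback_sq_le g (fun m => σ - lam m) (fun n => ⟪φ n, w⟫) i
  have hF := norm_sq_nonlinearity_le hN hχ hκ hFgrowth w y
  rw [norm_sq_eq_Pop_add hon N w, ← hf, ← hq, ← ha] at hF
  have hA := le_inner_sub_Pop_Aop hon htot hlam.monotone hw N
  rw [← hq] at hA
  have hcross : -2 * (lam N * t) * ⟪q, ∑ i, v i • χ i⟫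
      ≤ b / 2 * ‖Pop φ N w‖ ^ 2 + 2 * T / b * (lam N * t) ^ 2 * ‖q‖ ^ 2 := by
    refine cross_term_le hb hT (sq_nonneg _) (sq_nonneg _) ?_
    calc ⟪q, ∑ i, v i • χ i⟫ ^ 2 ≤ (‖q‖ * ‖∑ i, v i • χ i‖) ^ 2 :=
          sq_le_sq' (neg_le_of_abs_le (abs_real_inner_le_norm _ _)) (real_inner_le_norm _ _)
      _ = ‖q‖ ^ 2 * ∑ i, v i ^ 2 * ‖χ i‖ ^ 2 := by
          rw [mul_pow, norm_sum_smul_sq_of_orthogonal hχ]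
      _ ≤ ‖q‖ ^ 2 * (T * ‖Pop φ N w‖ ^ 2) := by
          refine mul_le_mul_of_nonneg_left ?_ (sq_nonneg _)
          rw [hT_def, Finset.sum_mul]
          refine Finset.sum_le_sum fun i _ => ?_
          nlinarith [mul_le_mul_of_nonneg_right (hvsq i) (sq_nonneg ‖χ i‖)]
  have hforce : 2 * σ * ⟪Pop φ N w, f⟫ + 2 * (lam N * t) * ⟪q, f⟫
      ≤ σ ^ 2 * ‖Pop φ N w‖ ^ 2 + (lam N * t) ^ 2 * ‖q‖ ^ 2 + ‖f‖ ^ 2 := by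
    have h := norm_sub_sq_real (σ • Pop φ N w + (lam N * t) • q) f
    rw [norm_smul_Pop_add_smul_sq hon, inner_add_left, real_inner_smul_left,
      real_inner_smul_left] at h
    linarith [sq_nonneg ‖σ • Pop φ N w + (lam N * t) • q - f‖]
  have hy : ∑ i, (ω i * y i * v i - μ i * ω i * y i ^ 2)
      + ∑ i, Lbar ^ 2 * (1 + 1 / κ) * ‖χ i‖ ^ 2 * y i ^ 2
      ≤ (b / 2 - d) * ‖Pop φ N w‖ ^ 2 - d * ∑ i, y i ^ 2 := by
    rw [← Finset.sum_add_distrib]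
    calc _ ≤ ∑ i, ((b / (2 * N) - d) * ‖Pop φ N w‖ ^ 2 - d * y i ^ 2) := by
          refine Finset.sum_le_sum fun i _ => (hωδ i _ _ _ (sq_nonneg _) (hvsq i)).trans ?_
          have h1 := mul_le_mul_of_nonneg_right (hdδ i) (sq_nonneg ‖Pop φ N w‖)
          have h2 := mul_le_mul_of_nonneg_right (hdδ i) (sq_nonneg (y i))
          linarith
      _ = (b / 2 - N * d) * ‖Pop φ N w‖ ^ 2 - d * ∑ i, y i ^ 2 := by
          rw [Finset.sum_sub_distrib, Finset.sum_const, Finset.card_univ, Fintype.card_fin,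
            nsmul_eq_mul, ← Finset.mul_sum]
          field_simp
      _ ≤ _ := by
          have := mul_le_mul_of_nonneg_right hN'
            (mul_nonneg hd.le (sq_nonneg ‖Pop φ N w‖))
          linarith
  have hdiss : 2 * (lam N * t) * (lam N * ‖q‖ ^ 2) ≤ 2 * (lam N * t) * ⟪q, Aop φ lam w⟫ :=
    mul_le_mul_of_nonneg_left hA (by positivity)
  have hquad : (lam N * t) ^ 2 * ‖q‖ ^ 2 + 2 * T / b * (lam N * t) ^ 2 * ‖q‖ ^ 2
      = lam N ^ 2 * t * ‖q‖ ^ 2 := by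
    linear_combination lam N ^ 2 * t * ‖q‖ ^ 2 * htD
  have hθ1 := mul_le_mul_of_nonneg_right (min_le_left d (lam N ^ 2 * t - a))
    (sq_nonneg ‖Pop φ N w‖)
  have hθ2 := mul_le_mul_of_nonneg_right (min_le_right d (lam N ^ 2 * t - a)) (sq_nonneg ‖q‖)
  have hθ3 := mul_le_mul_of_nonneg_right (min_le_left d (lam N ^ 2 * t - a))
    (show 0 ≤ ∑ i, y i ^ 2 by positivity)
  rw [VdotNL_eq hon, inner_Pop_closedLoop hon hw hv, norm_sq_eq_Pop_add hon N w, ← hq, ← hf,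
    inner_add_right, inner_sub_right, inner_neg_right]
  linarith
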